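/- arXiv:1002.3544 — 2 statements merged into one kernel-verified Lean document; each statement's English description precedes it below -/
import Mathlib

section
/- Let S be a finite nonempty type and w : S → S → ℝ. Let v_0, …, v_{p−1} (p ≥ 1) be pairwise distinct elements of S forming an irreducible cycle whose specific energy is minimal among all cycles. Define the p-periodic configuration a : ℤ → S by a(i) = v_{i mod p}. Then a is a ground state of the nearest-neighbour model with potential w: for every configuration s : ℤ → S such that {i ∈ ℤ : s(i) ≠ a(i)} is finite, the relative Hamiltonian H(s,a) = ∑_{i ∈ ℤ} [w(s(i), s(i+1)) − w(a(i), a(i+1))] (a sum with only finitely many nonzero terms) satisfies H(s,a) ≥ 0. -/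
/-- Total weight of a cycle `f : ZMod n → S` with edge weights `w`. (Zero for `n = 0`.) -/
noncomputable def totalWeight {S : Type*} (w : S → S → ℝ) (n : ℕ) (f : ZMod n → S) : ℝ :=
  if h : n = 0 then 0 else
    haveI : NeZero n := ⟨h⟩
    ∑ i : ZMod n, w (f i) (f (i + 1))

/-- Specific energy of a cycle: `(1/n)` times its total weight. -/
noncomputable def specificEnergy {S : Type*} (w : S → S → ℝ) (n : ℕ) (f : ZMod n → S) : ℝ :=
  (1 / (n : ℝ)) * totalWeight w n f

/-- The total weight of the cycle read off one period of a sequence is a sum over that period. -/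
theorem totalWeight_val_eq_sum_range {S : Type*} (w : S → S → ℝ) {n : ℕ} (hn : 1 ≤ n)
    (y : ℕ → S) (hy : y n = y 0) :
    totalWeight w n (fun j => y j.val) = ∑ k ∈ Finset.range n, w (y k) (y (k + 1)) := by
  obtain ⟨m, rfl⟩ : ∃ m, n = m + 1 := ⟨n - 1, by omega⟩
  rw [totalWeight, dif_neg m.succ_ne_zero, ← Fin.sum_univ_eq_sum_range]
  refine Finset.sum_congr rfl fun i _ => ?_
  change Fin (m + 1) at i
  change w (y i.val) (y (i + 1 : Fin (m + 1)).val) = _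
  congr 1
  rw [Fin.val_add_one]
  split_ifs with h
  · subst h
    simpa using hy.symm
  · rfl

theorem Function.Periodic.sum_range_mul {M : Type*} [Semiring M] {g : ℕ → M} {p : ℕ}
    (hg : Function.Periodic g p) (m : ℕ) :
    ∑ k ∈ Finset.range (m * p), g k = m * ∑ k ∈ Finset.range p, g k := by
  induction m with
  | zero => simp
  | succ m ih =>
    rw [Nat.succ_mul, Finset.sum_range_add, ih, Nat.cast_succ, add_mul, one_mul]
    congr 1
    refine Finset.sum_congr rfl fun k _ => ?_
    rw [add_comm]
    exact hg.nat_mul m k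

theorem Set.Finite.exists_pos_natAbs_lt {A : Set ℤ} (hA : A.Finite) :
    ∃ N : ℕ, 1 ≤ N ∧ ∀ i ∈ A, i.natAbs < N := by
  obtain ⟨N, hN⟩ := (hA.image Int.natAbs).bddAbove
  exact ⟨N + 1, by omega, fun i hi => Nat.lt_succ_of_le (hN ⟨i, hi, rfl⟩)⟩

/-- If `v : ZMod p → S` is an irreducible cycle whose specific energy is minimal among all
cycles, then the `p`-periodic configuration `a i = v (i mod p)` is a ground state of the
nearest-neighbour model with potential `w`: the relative Hamiltonian `H(s,a)` is nonnegative
for every configuration `s` equal to `a` almost everywhere. -/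
theorem periodic_min_cycle_is_ground_state {S : Type*} [Fintype S] [Nonempty S]
    (w : S → S → ℝ) (p : ℕ) (hp : 1 ≤ p) (v : ZMod p → S) (hv : Function.Injective v)
    (hmin : ∀ (n : ℕ), 1 ≤ n → ∀ f : ZMod n → S,
      specificEnergy w p v ≤ specificEnergy w n f)
    (a : ℤ → S) (ha : ∀ i : ℤ, a i = v (i : ZMod p)) :
    ∀ s : ℤ → S, {i : ℤ | s i ≠ a i}.Finite →
      0 ≤ ∑ᶠ i : ℤ, (w (s i) (s (i + 1)) - w (a i) (a (i + 1))) := by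
  intro s hs
  obtain ⟨N, hN1, hN⟩ := hs.exists_pos_natAbs_lt
  have heq : ∀ i : ℤ, N ≤ i.natAbs → s i = a i := fun i hi => by
    by_contra h
    exact absurd (hN i h) (by omega)
  have hNp : N ≤ N * p := Nat.le_mul_of_pos_right N hp
  have hn : 1 ≤ (2 * N) * p := Nat.mul_pos (by omega) hp
  have hM : (((2 * N) * p : ℕ) : ℤ) = 2 * ((N * p : ℕ) : ℤ) := by push_cast; ring
  set L : ℕ := N * p with hL
  have haper : ∀ (i : ℤ), a (-(L : ℤ) + i) = a i := fun i => by simp [ha, hL]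
  -- restrict the relative Hamiltonian to the window `[-L, L)`
  have hsum : ∑ᶠ i : ℤ, (w (s i) (s (i + 1)) - w (a i) (a (i + 1))) =
      ∑ k ∈ Finset.range ((2 * N) * p),
        (w (s (-(L : ℤ) + k)) (s (-(L : ℤ) + (k + 1 : ℕ))) - w (a k) (a (k + 1 : ℕ))) := by
    rw [finsum_eq_sum_of_support_subset
      (s := (Finset.range ((2 * N) * p)).image fun k : ℕ => -(L : ℤ) + k),
      Finset.sum_image (fun x _ y _ h => by simpa using h)]
    · refine Finset.sum_congr rfl fun k _ => ?_
      rw [add_assoc, haper, haper]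
      norm_cast
    · intro i hi
      have hi' : i.natAbs < N ∨ (i + 1).natAbs < N := by
        by_contra! h
        exact hi (by simp only [heq i h.1, heq (i + 1) h.2, sub_self])
      simp only [Finset.coe_image, Finset.coe_range, Set.mem_image, Set.mem_Iio]
      exact ⟨(i + L).toNat, by omega, by omega⟩
  have hends : s (-(L : ℤ) + ((2 * N) * p : ℕ)) = s (-(L : ℤ) + (0 : ℕ)) := by
    rw [heq _ (by omega), heq _ (by omega), haper, haper]
    simp [ha]
  have hv' : v = fun j => a (j.val : ℕ) := by
    have : NeZero p := ⟨by omega⟩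
    funext j
    simp [ha]
  have htv := totalWeight_val_eq_sum_range w hp (fun k : ℕ => a k) (by simp [ha])
  have htf := totalWeight_val_eq_sum_range w hn (fun k : ℕ => s (-(L : ℤ) + k)) hends
  have hper : Function.Periodic (fun k : ℕ => w (a k) (a (k + 1 : ℕ))) p := fun k => by
    simp [ha]
  have h := hmin _ hn fun j => s (-(L : ℤ) + (j.val : ℕ))
  rw [specificEnergy, specificEnergy, htf, hv', htv] at h
  rw [hsum, Finset.sum_sub_distrib, hper.sum_range_mul, sub_nonneg]
  have hp0 : (0 : ℝ) < p := by exact_mod_cast hp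
  have hn0 : (0 : ℝ) < ((2 * N) * p : ℕ) := by exact_mod_cast hn
  rw [one_div_mul_eq_div, one_div_mul_eq_div, le_div_iff₀ hn0] at h
  refine le_trans (le_of_eq ?_) h
  rw [Nat.cast_mul _ p]
  field_simp
end

section
/- (Peierls condition for one-dimensional nearest-neighbour models.) Let S be a finite nonempty type, Q ⊆ S a nonempty subset, and w : S → S → ℝ a potential such that: (i) w(q,q) = 0 for every q ∈ Q; (ii) every cycle has total weight ≥ 0; (iii) every irreducible cycle which is not the length-1 loop at some element of Q has total weight > 0. Then there exists a constant c > 0 such that for every q ∈ Q and every configuration s : ℤ → S that equals the constant configuration with value q outside a finite set, ∑_{i ∈ ℤ} w(s(i), s(i+1)) ≥ c · n, where n is the number of boundary sites of s (the sum on the left has only finitely many nonzero terms and equals the relative Hamiltonian H(s, s_q)). -/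
/-- A weight whose total over every irreducible closed walk is nonnegative has nonnegative total
over every closed walk. -/
theorem sum_closed_walk_nonneg {S : Type*} (v : S → S → ℝ)
    (hv : ∀ (n : ℕ) (f : ℕ → S), 1 ≤ n → Set.InjOn f (Set.Iio n) → f n = f 0 →
      0 ≤ ∑ i ∈ Finset.range n, v (f i) (f (i + 1)))
    (n : ℕ) (f : ℕ → S) (hf : f n = f 0) :
    0 ≤ ∑ i ∈ Finset.range n, v (f i) (f (i + 1)) := by
  induction n using Nat.strong_induction_on generalizing f with
  | _ n ih =>
    rcases Nat.eq_zero_or_pos n with rfl | hn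
    · simp
    by_cases hinj : Set.InjOn f (Set.Iio n)
    · exact hv n f hn hinj hf
    obtain ⟨i, j, hij, hjn, hfij⟩ : ∃ i j, i < j ∧ j < n ∧ f i = f j := by
      simp only [Set.InjOn, Set.mem_Iio] at hinj
      push Not at hinj
      obtain ⟨a, ha, b, hb, hab, hne⟩ := hinj
      rcases lt_or_gt_of_ne hne with h | h
      · exact ⟨a, b, h, hb, hab⟩
      · exact ⟨b, a, h, ha, hab.symm⟩
    obtain ⟨d, rfl⟩ := Nat.exists_eq_add_of_lt hij
    obtain ⟨r, rfl⟩ := Nat.exists_eq_add_of_lt hjn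
    have hloop := ih (d + 1) (by omega) (fun k => f (i + k)) (by simpa [add_assoc] using hfij.symm)
    let g : ℕ → S := fun k => if k ≤ i then f k else f (k + (d + 1))
    have hg_le : ∀ k, k ≤ i → g k = f k := fun k hk => by simp [g, hk]
    have hg_ge : ∀ k, g (i + k) = f (i + (d + 1) + k) := by
      intro k
      rcases Nat.eq_zero_or_pos k with rfl | hk
      · simpa [g, add_assoc] using hfij
      · have : ¬ i + k ≤ i := by omega
        simp only [g, this, if_false]
        congr 1
        omega
    have hrest := ih (i + (r + 1)) (by omega) g (by
      rw [hg_ge, hg_le 0 (by omega), ← hf]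
      congr 1)
    rw [Finset.sum_range_add] at hrest
    have h1 : ∑ k ∈ Finset.range i, v (g k) (g (k + 1)) =
        ∑ k ∈ Finset.range i, v (f k) (f (k + 1)) := by
      refine Finset.sum_congr rfl fun k hk => ?_
      have := Finset.mem_range.1 hk
      rw [hg_le k (by omega), hg_le (k + 1) (by omega)]
    have h2 : ∑ k ∈ Finset.range (r + 1), v (g (i + k)) (g (i + k + 1)) =
        ∑ k ∈ Finset.range (r + 1), v (f (i + (d + 1) + k)) (f (i + (d + 1) + k + 1)) := by
      refine Finset.sum_congr rfl fun k _ => ?_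
      rw [add_assoc i k 1, hg_ge, hg_ge]
      simp only [add_assoc]
    have hn_eq : i + d + 1 + r + 1 = i + (d + 1) + (r + 1) := by omega
    rw [hn_eq, Finset.sum_range_add, Finset.sum_range_add]
    rw [h1, h2] at hrest
    simp only [← add_assoc] at hloop hrest ⊢
    linarith

theorem totalWeight_succ_eq_sum_range {S : Type*} (w : S → S → ℝ) (k : ℕ) (f : ℕ → S)
    (hf : f (k + 1) = f 0) :
    totalWeight w (k + 1) (fun i => f i.val) =
      ∑ i ∈ Finset.range (k + 1), w (f i) (f (i + 1)) := by
  rw [totalWeight, dif_neg k.succ_ne_zero,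
    ← Fin.sum_univ_eq_sum_range (fun i => w (f i) (f (i + 1)))]
  refine Finset.sum_congr rfl fun (i : Fin (k + 1)) _ => ?_
  change w (f i.val) (f (i + 1).val) = _
  congr 1
  rw [Fin.val_add_one]
  split_ifs with h
  · rw [h, Fin.val_last, hf]
  · rfl

/-- The weights of the irreducible cycles which are not loops in `Q` are bounded below by a
positive multiple of the cardinality of `S`. -/
theorem exists_pos_mul_card_le_totalWeight {S : Type*} [Fintype S] (Q : Set S) (w : S → S → ℝ)
    (hpos : ∀ (n : ℕ), 1 ≤ n → ∀ f : ZMod n → S, Function.Injective f →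
      ¬ (n = 1 ∧ f 0 ∈ Q) → 0 < totalWeight w n f) :
    ∃ ε > (0 : ℝ), ∀ (n : ℕ), 1 ≤ n → ∀ f : ZMod n → S, Function.Injective f →
      ¬ (n = 1 ∧ f 0 ∈ Q) → ε * n ≤ totalWeight w n f := by
  have key : ∀ x : (Σ n : Fin (Fintype.card S), (ZMod (n.val + 1) → S)),
      ∀ᶠ ε : ℝ in nhdsWithin 0 (Set.Ioi 0), Function.Injective x.2 →
        ¬ (x.1.val + 1 = 1 ∧ x.2 0 ∈ Q) →
          ε * ((x.1.val + 1 : ℕ) : ℝ) ≤ totalWeight w (x.1.val + 1) x.2 := by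
    rintro ⟨n, f⟩
    by_cases h : Function.Injective f ∧ ¬ (n.val + 1 = 1 ∧ f 0 ∈ Q)
    · have hw := hpos _ (by omega) f h.1 h.2
      have ht : Filter.Tendsto (fun ε : ℝ => ε * ((n.val + 1 : ℕ) : ℝ))
          (nhdsWithin 0 (Set.Ioi 0)) (nhds 0) := by
        have : Continuous fun ε : ℝ => ε * ((n.val + 1 : ℕ) : ℝ) := by fun_prop
        simpa using (this.tendsto 0).mono_left nhdsWithin_le_nhds
      filter_upwards [ht.eventually (eventually_lt_nhds hw)] with ε hε _ _ using hε.le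
    · exact Filter.Eventually.of_forall fun ε h1 h2 => (h ⟨h1, h2⟩).elim
  have : ∀ n : Fin (Fintype.card S), Finite (ZMod (n.val + 1) → S) := fun n => inferInstance
  obtain ⟨ε, hε, hε0⟩ := ((Filter.eventually_all.2 key).and self_mem_nhdsWithin).exists
  refine ⟨ε, hε0, fun n hn f hf hne => ?_⟩
  obtain ⟨k, rfl⟩ := Nat.exists_eq_add_of_le' hn
  have hcard := Fintype.card_le_of_injective f hf
  rw [ZMod.card] at hcard
  exact hε ⟨⟨k, hcard⟩, f⟩ hf hne

open Classical in
/-- The total weight of a closed walk dominates the number of its steps which are not loops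
in `Q`. -/
theorem exists_pos_mul_card_le_sum_closed_walk {S : Type*} [Fintype S] (Q : Set S)
    (w : S → S → ℝ) (h0 : ∀ q ∈ Q, w q q = 0)
    (hpos : ∀ (n : ℕ), 1 ≤ n → ∀ f : ZMod n → S, Function.Injective f →
      ¬ (n = 1 ∧ f 0 ∈ Q) → 0 < totalWeight w n f) :
    ∃ ε > (0 : ℝ), ∀ (n : ℕ) (f : ℕ → S), f n = f 0 →
      ε * ∑ i ∈ Finset.range n, (if f i = f (i + 1) ∧ f i ∈ Q then (0 : ℝ) else 1) ≤
        ∑ i ∈ Finset.range n, w (f i) (f (i + 1)) := by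
  obtain ⟨ε, hε0, hε⟩ := exists_pos_mul_card_le_totalWeight Q w hpos
  refine ⟨ε, hε0, fun n f hf => ?_⟩
  have := sum_closed_walk_nonneg
    (fun a b => w a b - ε * (if a = b ∧ a ∈ Q then (0 : ℝ) else 1)) ?_ n f hf
  · rw [Finset.sum_sub_distrib, ← Finset.mul_sum] at this
    linarith
  intro n f hn hinj hf
  obtain ⟨k, rfl⟩ := Nat.exists_eq_add_of_le' hn
  by_cases hQ : k = 0 ∧ f 0 ∈ Q
  · obtain ⟨rfl, hq⟩ := hQ
    have hf' : f 1 = f 0 := hf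
    simp [hf', hq, h0]
  have hcyc := hε (k + 1) hn (fun i => f i.val)
    (fun a b hab => ZMod.val_injective _ (hinj (ZMod.val_lt a) (ZMod.val_lt b) hab))
    (by simpa using hQ)
  rw [totalWeight_succ_eq_sum_range w k f hf] at hcyc
  rw [Finset.sum_sub_distrib, ← Finset.mul_sum]
  have hle : ∑ i ∈ Finset.range (k + 1), (if f i = f (i + 1) ∧ f i ∈ Q then (0 : ℝ) else 1) ≤
      ((k + 1 : ℕ) : ℝ) := by
    refine (Finset.sum_le_card_nsmul _ _ 1 fun i _ => ?_).trans (by simp)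
    split_ifs <;> norm_num
  have := mul_le_mul_of_nonneg_left hle hε0.le
  linarith

theorem sum_Ico_int_eq_sum_range (K : ℕ) (F : ℤ → ℝ) :
    ∑ i ∈ Finset.Ico (-K : ℤ) K, F i = ∑ k ∈ Finset.range (2 * K), F (k - K) := by
  symm
  refine Finset.sum_bij (fun k _ => (k : ℤ) - K) ?_ ?_ ?_ ?_
  · intro k hk
    simp only [Finset.mem_range, Finset.mem_Ico] at hk ⊢
    omega
  · intro a _ b _ h
    omega
  · intro b hb
    simp only [Finset.mem_Ico] at hb
    exact ⟨(b + K).toNat, by simp only [Finset.mem_range]; omega, by omega⟩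
  · intro k _
    rfl

/-- Peierls condition for one-dimensional nearest-neighbour models.  If `w` vanishes on the
diagonal of `Q`, every cycle has nonnegative total weight, and every irreducible cycle other
than a length-one loop at an element of `Q` has strictly positive total weight, then there is
`c > 0` such that for every `q ∈ Q` and every configuration `s` equal to the constant
configuration `q` almost everywhere, the energy `∑ i, w (s i) (s (i+1))` is at least `c`
times the number of boundary sites of `s`. -/
theorem peierls_condition_nearest_neighbour {S : Type*} [Fintype S] [Nonempty S]
    (Q : Set S) (hQ : Q.Nonempty) (w : S → S → ℝ)
    (h0 : ∀ q ∈ Q, w q q = 0)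
    (hnonneg : ∀ (n : ℕ), 1 ≤ n → ∀ f : ZMod n → S, 0 ≤ totalWeight w n f)
    (hpos : ∀ (n : ℕ), 1 ≤ n → ∀ f : ZMod n → S, Function.Injective f →
      ¬ (n = 1 ∧ f 0 ∈ Q) → 0 < totalWeight w n f) :
    ∃ c > (0 : ℝ), ∀ q ∈ Q, ∀ s : ℤ → S, {i : ℤ | s i ≠ q}.Finite →
      c * ({i : ℤ | ¬ (s (i - 1) = s i ∧ s i = s (i + 1) ∧ s i ∈ Q)}.ncard : ℝ)
        ≤ ∑ᶠ i : ℤ, w (s i) (s (i + 1)) := by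
  classical
  obtain ⟨ε, hε0, hε⟩ := exists_pos_mul_card_le_sum_closed_walk Q w h0 hpos
  refine ⟨ε / 2, by positivity, fun q hq s hs => ?_⟩
  obtain ⟨M, hM⟩ := (hs.image Int.natAbs).bddAbove
  have hout : ∀ i : ℤ, M < i.natAbs → s i = q := by
    intro i hi
    by_contra h
    exact absurd (hM ⟨i, h, rfl⟩) (by omega)
  obtain ⟨K, hK⟩ : ∃ K : ℕ, K = M + 1 := ⟨_, rfl⟩
  have hgood : ∀ i : ℤ, i ∉ Finset.Ico (-K : ℤ) K → s i = q ∧ s (i + 1) = q := by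
    intro i hi
    simp only [Finset.mem_Ico] at hi
    exact ⟨hout _ (by omega), hout _ (by omega)⟩
  rw [finsum_eq_sum_of_support_subset (s := Finset.Ico (-K : ℤ) K) _ (by
    intro i hi
    by_contra h
    obtain ⟨h1, h2⟩ := hgood i h
    exact hi (by simp only [h1, h2, h0 q hq]))]
  set B := (Finset.Ico (-K : ℤ) K).filter fun i => ¬ (s i = s (i + 1) ∧ s i ∈ Q) with hB
  have hmem : ∀ i : ℤ, ¬ (s i = s (i + 1) ∧ s i ∈ Q) → i ∈ B := by
    intro i hi
    refine Finset.mem_filter.2 ⟨?_, hi⟩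
    by_contra h
    obtain ⟨h1, h2⟩ := hgood i h
    exact hi ⟨h1.trans h2.symm, h1 ▸ hq⟩
  have hsub : {i : ℤ | ¬ (s (i - 1) = s i ∧ s i = s (i + 1) ∧ s i ∈ Q)} ⊆
      ((B ∪ B.image (· + 1) : Finset ℤ) : Set ℤ) := by
    intro i hi
    rw [Finset.mem_coe, Finset.mem_union, Finset.mem_image]
    by_cases h : s i = s (i + 1) ∧ s i ∈ Q
    · refine Or.inr ⟨i - 1, hmem _ fun h' => hi ⟨?_, h⟩, by ring⟩
      simpa using h'.1
    · exact Or.inl (hmem i h)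
  have hcard : {i : ℤ | ¬ (s (i - 1) = s i ∧ s i = s (i + 1) ∧ s i ∈ Q)}.ncard ≤ 2 * B.card := by
    refine (Set.ncard_le_ncard hsub (Finset.finite_toSet _)).trans ?_
    rw [Set.ncard_coe_finset]
    have h1 := Finset.card_union_le B (B.image (· + 1))
    have h2 := Finset.card_image_le (s := B) (f := (· + 1))
    omega
  have hcard' : (({i : ℤ | ¬ (s (i - 1) = s i ∧ s i = s (i + 1) ∧ s i ∈ Q)}.ncard : ℕ) : ℝ) ≤
      2 * B.card := by exact_mod_cast hcard
  have hBsum : (B.card : ℝ) =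
      ∑ i ∈ Finset.Ico (-K : ℤ) K, (if s i = s (i + 1) ∧ s i ∈ Q then (0 : ℝ) else 1) := by
    rw [hB, Finset.card_filter]
    push_cast
    exact Finset.sum_congr rfl fun i _ => ite_not ..
  have hwalk := hε (2 * K) (fun k => s (k - K)) (by
    rw [hout _ (by push_cast; omega), hout _ (by push_cast; omega)])
  have hcast : ∀ k : ℕ, ((k + 1 : ℕ) : ℤ) - K = (k : ℤ) - K + 1 := fun k => by push_cast; ring
  simp only [hcast] at hwalk
  rw [← sum_Ico_int_eq_sum_range K fun i => if s i = s (i + 1) ∧ s i ∈ Q then (0 : ℝ) else 1,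
    ← sum_Ico_int_eq_sum_range K fun i => w (s i) (s (i + 1)), ← hBsum] at hwalk
  have := mul_le_mul_of_nonneg_left hcard' (half_pos hε0).le
  linarith
end
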